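/- arXiv:2110.04302 — 2 statements merged into one kernel-verified Lean document; each statement's English description precedes it below -/
import Mathlib

section
/- For every real constant c with 1/2 ≤ c ≤ 1, the quantity n² · ∏_{p prime, p_n < p ≤ (p_n#)^c} (p−2)/p tends to 1/c² as n → ∞. (This is the case k = 2 of the asymptotic L_2(p_n; n) ~ θ_2 n^{−2} with θ_2 → 1/c².) -/
open Filter Finset

/-- `nthPrime n` is the `n`-th prime `pₙ`, with `p₁ = 2`. -/
noncomputable def nthPrime (n : ℕ) : ℕ := Nat.nth Nat.Prime (n - 1)

/-- `primorial' n = pₙ# = ∏_{i=1}^{n} pᵢ`, the product of the first `n` primes. -/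
noncomputable def primorial' (n : ℕ) : ℕ := ∏ i ∈ Finset.range n, Nat.nth Nat.Prime i

theorem log_factorial_eq_sum (N : ℕ) :
    Real.log (N.factorial) =
      ∑ p ∈ Nat.primesLE N, (N.factorial.factorization p : ℝ) * Real.log p := by
  have h := Nat.prod_factorization_pow_eq_self (Nat.factorial_ne_zero N)
  have hs : N.factorial.factorization.support ⊆ Nat.primesLE N := by
    intro p hp
    have hp' := Nat.prime_of_mem_primeFactors hp
    have hd := Nat.dvd_of_mem_primeFactors hp
    exact Nat.mem_primesLE.2 ⟨(hp'.dvd_factorial).1 hd, hp'⟩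
  rw [Finsupp.prod_of_support_subset _ hs _ (by simp)] at h
  conv_lhs => rw [← h]
  push_cast
  rw [Real.log_prod (by
    intro p hp
    have := (Nat.prime_of_mem_primesLE hp).pos
    positivity)]
  simp [Real.log_pow]

theorem summable_log_div_mul_sub_one :
    Summable (fun n : ℕ => Real.log n / (n * (n - 1))) := by
  have h : Summable (fun n : ℕ => 4 * (1 / (n : ℝ) ^ (3 / 2 : ℝ))) :=
    (Real.summable_one_div_nat_rpow.2 (by norm_num)).mul_left 4
  refine Summable.of_nonneg_of_le (fun n => ?_) (fun n => ?_) h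
  · rcases Nat.eq_zero_or_pos n with rfl | hn
    · simp
    · have : (1 : ℝ) ≤ n := by exact_mod_cast hn
      exact div_nonneg (Real.log_nonneg this) (mul_nonneg (by linarith) (by linarith))
  · rcases lt_or_ge n 2 with hn | hn
    · interval_cases n <;> simp
    · have h2 : (2 : ℝ) ≤ n := by exact_mod_cast hn
      have hl := Real.log_le_rpow_div (x := n) (by positivity) (ε := 1 / 2) (by norm_num)
      have e : (n : ℝ) ^ (3 / 2 : ℝ) * (n : ℝ) ^ (1 / 2 : ℝ) = n ^ 2 := by
        rw [← Real.rpow_add (by positivity)]; norm_num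
      rw [mul_one_div, div_le_div_iff₀ (by nlinarith) (by positivity)]
      have hp : 0 < (n : ℝ) ^ (3 / 2 : ℝ) := by positivity
      have : Real.log n * (n : ℝ) ^ (3 / 2 : ℝ) ≤ 2 * n ^ 2 := by
        rw [← e]
        calc _ ≤ ((n : ℝ) ^ (1 / 2 : ℝ) / (1 / 2)) * (n : ℝ) ^ (3 / 2 : ℝ) := by gcongr
          _ = _ := by ring
      nlinarith

/-- Mertens' first theorem at natural numbers. -/
theorem exists_abs_sum_primesLE_log_div_sub_log_le :
    ∃ C : ℝ, ∀ N : ℕ, 1 ≤ N → |∑ p ∈ Nat.primesLE N, Real.log p / p - Real.log N| ≤ C := by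
  set S := ∑' n : ℕ, Real.log n / ((n : ℝ) * (n - 1)) with hS
  refine ⟨max (Real.log 4) (1 + S), fun N hN => ?_⟩
  have hN' : (1 : ℝ) ≤ N := by exact_mod_cast hN
  have hN0 : (0 : ℝ) < N := by linarith
  set A := ∑ p ∈ Nat.primesLE N, Real.log p / p with hA
  have hfac := log_factorial_eq_sum N
  have hupper : Real.log N.factorial ≤ N * Real.log N := by
    rw [← Real.log_pow]
    exact Real.log_le_log (by positivity) (by exact_mod_cast Nat.factorial_le_pow N)
  have hlower : N * Real.log N - N ≤ Real.log N.factorial := by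
    have := Stirling.le_log_factorial_stirling (n := N) (by lia)
    have h1 := Real.log_nonneg hN'
    have h2 : 0 ≤ Real.log (2 * Real.pi) := Real.log_nonneg (by nlinarith [Real.pi_gt_three])
    linarith
  have hge : N * A - Chebyshev.theta N ≤ Real.log N.factorial := by
    rw [hfac, Chebyshev.theta_eq_sum_primesLE_log, hA, mul_sum, ← sum_sub_distrib]
    refine sum_le_sum fun p hp => ?_
    have hpp := Nat.prime_of_mem_primesLE hp
    have hp0 : (0 : ℝ) < p := by exact_mod_cast hpp.pos
    have hlog : 0 ≤ Real.log p := Real.log_natCast_nonneg p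
    have hv : N / p ≤ N.factorial.factorization p := by
      rw [Nat.factorization_factorial hpp (b := Nat.log p N + 2) (by lia)]
      simpa using single_le_sum (f := fun i => N / p ^ i) (fun _ _ => Nat.zero_le _)
        (show 1 ∈ Ico 1 (Nat.log p N + 2) by simp)
    have hfl : (N : ℝ) / p - 1 ≤ (N / p : ℕ) := by
      rw [← Nat.floor_div_eq_div (K := ℝ)]
      exact (Nat.sub_one_lt_floor _).le
    have hv' : (N : ℝ) / p - 1 ≤ N.factorial.factorization p := hfl.trans (by exact_mod_cast hv)
    calc (N : ℝ) * (Real.log p / p) - Real.log p = (N / p - 1) * Real.log p := by ring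
      _ ≤ _ := by gcongr
  have hle : Real.log N.factorial ≤ N * A + N * S := by
    have hsum : ∑ p ∈ Nat.primesLE N, Real.log p / ((p : ℝ) * (p - 1)) ≤ S := by
      refine summable_log_div_mul_sub_one.sum_le_tsum _ fun n _ => ?_
      rcases Nat.eq_zero_or_pos n with rfl | hn
      · simp
      · have : (1 : ℝ) ≤ n := by exact_mod_cast hn
        exact div_nonneg (Real.log_nonneg this) (mul_nonneg (by linarith) (by linarith))
    refine le_trans ?_ (add_le_add_right (mul_le_mul_of_nonneg_left hsum hN0.le) _)
    rw [hfac, hA, mul_sum, mul_sum, ← sum_add_distrib]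
    refine sum_le_sum fun p hp => ?_
    have hpp := Nat.prime_of_mem_primesLE hp
    have hp2 : (2 : ℝ) ≤ p := by exact_mod_cast hpp.two_le
    have hlog : 0 ≤ Real.log p := Real.log_natCast_nonneg p
    have hv : (N.factorial.factorization p : ℝ) ≤ N / (p - 1) := by
      have h := Nat.factorization_factorial_le_div_pred hpp N
      have h' : (N.factorial.factorization p : ℝ) ≤ (N / (p - 1) : ℕ) := by exact_mod_cast h
      refine h'.trans (Nat.cast_div_le.trans ?_)
      rw [Nat.cast_sub hpp.one_le, Nat.cast_one]
    calc _ ≤ (N / (p - 1) : ℝ) * Real.log p := by gcongr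
      _ = _ := by
        have : (p : ℝ) - 1 ≠ 0 := by linarith
        field_simp
        ring
  have htheta := Chebyshev.theta_le_log4_mul_x hN0.le
  rw [abs_le]
  constructor
  · have : 0 ≤ A - Real.log N + (1 + S) := by
      by_contra! h
      nlinarith
    linarith [le_max_right (Real.log 4) (1 + S)]
  · refine le_trans ?_ (le_max_left _ _)
    by_contra! h
    nlinarith

/-- Mertens' first theorem at real numbers. -/
theorem exists_abs_sum_log_div_sub_log_le :
    ∃ D : ℝ, 0 ≤ D ∧ ∀ t : ℝ, 1 ≤ t →
      |∑ k ∈ Icc 0 ⌊t⌋₊, (if k.Prime then Real.log k / k else 0) - Real.log t| ≤ D := by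
  obtain ⟨C, hC⟩ := exists_abs_sum_primesLE_log_div_sub_log_le
  have hC0 : 0 ≤ C := (abs_nonneg _).trans (hC 1 le_rfl)
  have hl2 : 0 ≤ Real.log 2 := Real.log_nonneg (by norm_num)
  refine ⟨C + Real.log 2, by positivity, fun t ht => ?_⟩
  have hfl : 1 ≤ ⌊t⌋₊ := Nat.one_le_floor_iff _ |>.2 ht
  have hfl' : (1 : ℝ) ≤ ⌊t⌋₊ := by exact_mod_cast hfl
  have h := hC ⌊t⌋₊ hfl
  rw [Nat.primesLE_eq_filter_Icc_zero, sum_filter] at h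
  have h1 : Real.log ⌊t⌋₊ ≤ Real.log t :=
    Real.log_le_log (by linarith) (Nat.floor_le (by linarith))
  have h2 : Real.log t ≤ Real.log 2 + Real.log ⌊t⌋₊ := by
    rw [← Real.log_mul (by norm_num) (by linarith)]
    exact Real.log_le_log (by linarith) (by linarith [Nat.lt_floor_add_one t])
  rw [abs_le] at h ⊢
  constructor <;> linarith [h.1, h.2]

theorem hasDerivAt_inv_log {t : ℝ} (ht : 1 < t) :
    HasDerivAt (fun u => (Real.log u)⁻¹) (-(t * Real.log t ^ 2)⁻¹) t := by
  have := (Real.hasDerivAt_log (by linarith : t ≠ 0)).inv (Real.log_pos ht).ne'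
  convert! this using 1
  have := (Real.log_pos ht).ne'
  field_simp

theorem hasDerivAt_log_log {t : ℝ} (ht : 1 < t) :
    HasDerivAt (fun u => Real.log (Real.log u)) (t * Real.log t)⁻¹ t := by
  have := (Real.hasDerivAt_log (by linarith : t ≠ 0)).log (Real.log_pos ht).ne'
  convert! this using 1
  have := (Real.log_pos ht).ne'
  field_simp

/-- Mertens' second theorem, for the sum of prime reciprocals over an interval. -/
theorem exists_abs_sum_inv_prime_sub_le :
    ∃ D : ℝ, ∀ a b : ℝ, 2 ≤ a → a ≤ b →
      |∑ p ∈ Ioc ⌊a⌋₊ ⌊b⌋₊ with p.Prime, (p : ℝ)⁻¹ -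
        (Real.log (Real.log b) - Real.log (Real.log a))| ≤ D / Real.log a := by
  obtain ⟨D, hD0, hD⟩ := exists_abs_sum_log_div_sub_log_le
  refine ⟨3 * D, fun a b ha hab => ?_⟩
  set c : ℕ → ℝ := fun k => if k.Prime then Real.log k / k else 0 with hc
  set S : ℝ → ℝ := fun t => ∑ k ∈ Icc 0 ⌊t⌋₊, c k with hS
  have hgt : ∀ t ∈ Set.Icc a b, 1 < t := fun t ht => by linarith [ht.1]
  have hla : 0 < Real.log a := Real.log_pos (by linarith)
  have hlb : 0 < Real.log b := Real.log_pos (by linarith)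
  have hlab : Real.log a ≤ Real.log b := Real.log_le_log (by linarith) hab
  have hderiv : ∀ t ∈ Set.Icc a b,
      deriv (fun u => (Real.log u)⁻¹) t = -(t * Real.log t ^ 2)⁻¹ :=
    fun t ht => (hasDerivAt_inv_log (hgt t ht)).deriv
  have hcont₁ : ContinuousOn (fun t : ℝ => -(t * Real.log t ^ 2)⁻¹) (Set.Icc a b) := by
    refine ContinuousOn.neg (ContinuousOn.inv₀ (ContinuousOn.mul continuousOn_id
      ((Real.continuousOn_log.mono fun t ht => ?_).pow 2)) fun t ht => ?_)
    · have := hgt t ht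
      simp; linarith
    · have := hgt t ht
      have := Real.log_pos this
      positivity
  have hcont₂ : ContinuousOn (fun t : ℝ => (t * Real.log t)⁻¹) (Set.Icc a b) := by
    refine ContinuousOn.inv₀ (ContinuousOn.mul continuousOn_id
      (Real.continuousOn_log.mono fun t ht => ?_)) fun t ht => ?_
    · have := hgt t ht
      simp; linarith
    · have := hgt t ht
      have := Real.log_pos this
      positivity
  have hint : MeasureTheory.IntegrableOn (deriv fun u => (Real.log u)⁻¹) (Set.Icc a b) :=
    (hcont₁.congr hderiv).integrableOn_Icc
  have habel := sum_mul_eq_sub_sub_integral_mul c (by linarith) hab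
    (fun t ht => (hasDerivAt_inv_log (hgt t ht)).differentiableAt) hint
  have hintS := integrableOn_mul_sum_Icc c (m := 0) (by linarith) hint
  rw [← intervalIntegral.integral_of_le hab] at habel
  have hi₁ : IntervalIntegrable (fun t => deriv (fun u => (Real.log u)⁻¹) t * S t)
      MeasureTheory.volume a b :=
    (intervalIntegrable_iff_integrableOn_Icc_of_le hab).2 hintS
  have hi₂ : IntervalIntegrable (fun t : ℝ => (t * Real.log t)⁻¹) MeasureTheory.volume a b :=
    hcont₂.intervalIntegrable_of_Icc hab
  have hi₃ : IntervalIntegrable (fun t : ℝ => -(t * Real.log t ^ 2)⁻¹)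
      MeasureTheory.volume a b := hcont₁.intervalIntegrable_of_Icc hab
  have hJ : ∫ t in a..b, (t * Real.log t)⁻¹ = Real.log (Real.log b) - Real.log (Real.log a) :=
    intervalIntegral.integral_eq_sub_of_hasDerivAt (fun t ht =>
      hasDerivAt_log_log (hgt t (by rwa [Set.uIcc_of_le hab] at ht))) hi₂
  have hK : ∫ t in a..b, -(t * Real.log t ^ 2)⁻¹ = (Real.log b)⁻¹ - (Real.log a)⁻¹ :=
    intervalIntegral.integral_eq_sub_of_hasDerivAt (fun t ht =>
      hasDerivAt_inv_log (hgt t (by rwa [Set.uIcc_of_le hab] at ht))) hi₃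
  have herr : |(∫ t in a..b, deriv (fun u => (Real.log u)⁻¹) t * S t) +
      ∫ t in a..b, (t * Real.log t)⁻¹| ≤ (-D) * ((Real.log b)⁻¹ - (Real.log a)⁻¹) := by
    rw [← intervalIntegral.integral_add hi₁ hi₂, ← hK, ← intervalIntegral.integral_const_mul]
    rw [← Real.norm_eq_abs]
    refine intervalIntegral.norm_integral_le_of_norm_le hab (Eventually.of_forall fun t ht => ?_)
      (hi₃.const_mul _)
    have ht' : t ∈ Set.Icc a b := Set.Ioc_subset_Icc_self ht
    have h1 := hgt t ht'
    have hl := Real.log_pos h1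
    have e : deriv (fun u => (Real.log u)⁻¹) t * S t + (t * Real.log t)⁻¹ =
        -(t * Real.log t ^ 2)⁻¹ * (S t - Real.log t) := by
      rw [hderiv t ht']
      field_simp
      ring
    rw [e, norm_mul, norm_neg, Real.norm_of_nonneg (by positivity), neg_mul_neg, mul_comm]
    exact mul_le_mul_of_nonneg_right (hD t h1.le) (by positivity)
  have hsum : ∑ p ∈ Ioc ⌊a⌋₊ ⌊b⌋₊ with p.Prime, (p : ℝ)⁻¹ =
      ∑ k ∈ Ioc ⌊a⌋₊ ⌊b⌋₊, (Real.log k)⁻¹ * c k := by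
    rw [sum_filter]
    refine sum_congr rfl fun k _ => ?_
    simp only [hc]
    split_ifs with hk
    · have : 0 < Real.log k := Real.log_pos (by exact_mod_cast hk.one_lt)
      field_simp
    · simp
  have hRa := hD a (by linarith)
  have hRb := hD b (by linarith)
  have hEa : |(Real.log a)⁻¹ * S a - 1| ≤ D * (Real.log a)⁻¹ := by
    have : (Real.log a)⁻¹ * S a - 1 = (S a - Real.log a) * (Real.log a)⁻¹ := by
      field_simp
    rw [this, abs_mul, abs_of_pos (inv_pos.2 hla)]
    exact mul_le_mul_of_nonneg_right hRa (by positivity)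
  have hEb : |(Real.log b)⁻¹ * S b - 1| ≤ D * (Real.log b)⁻¹ := by
    have : (Real.log b)⁻¹ * S b - 1 = (S b - Real.log b) * (Real.log b)⁻¹ := by
      field_simp
    rw [this, abs_mul, abs_of_pos (inv_pos.2 hlb)]
    exact mul_le_mul_of_nonneg_right hRb (by positivity)
  have hDab : D * (Real.log b)⁻¹ ≤ D * (Real.log a)⁻¹ := by gcongr
  rw [hsum, habel]
  rw [hJ] at herr
  simp only [hS] at hEa hEb herr
  rw [div_eq_mul_inv]
  rw [abs_le] at *
  constructor <;> linarith [hEa.1, hEa.2, hEb.1, hEb.2, herr.1, herr.2]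

theorem abs_log_sub_two_div_add_le {x : ℝ} (hx : 3 ≤ x) :
    |Real.log ((x - 2) / x) + 2 * x⁻¹| ≤ 12 * (x ^ 2)⁻¹ := by
  have hpos : 0 < (x - 2) / x := div_pos (by linarith) (by linarith)
  have hx2 : x - 2 ≠ 0 := by linarith
  have h1 := Real.log_le_sub_one_of_pos hpos
  have h2 := Real.one_sub_inv_le_log_of_pos hpos
  have e1 : (x - 2) / x - 1 = -(2 * x⁻¹) := by field_simp; ring
  have e2 : 1 - ((x - 2) / x)⁻¹ = -(2 * x⁻¹) - 4 / (x * (x - 2)) := by field_simp; ring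
  have h3 : 4 / (x * (x - 2)) ≤ 12 * (x ^ 2)⁻¹ := by
    rw [← div_eq_mul_inv, div_le_div_iff₀ (by nlinarith) (by positivity)]
    nlinarith
  have h4 : 0 ≤ 12 * (x ^ 2)⁻¹ := by positivity
  rw [abs_le]
  constructor <;> linarith

theorem exists_abs_sum_log_prime_sub_two_div_add_le :
    ∃ D : ℝ, ∀ (m : ℕ) (b : ℝ), 2 ≤ m → (m : ℝ) ≤ b →
      |∑ p ∈ Ioc m ⌊b⌋₊ with p.Prime, Real.log (((p : ℝ) - 2) / p) +
        2 * (Real.log (Real.log b) - Real.log (Real.log m))| ≤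
          2 * (D / Real.log m) + 12 * (m : ℝ)⁻¹ := by
  obtain ⟨D, hD⟩ := exists_abs_sum_inv_prime_sub_le
  refine ⟨D, fun m b hm hmb => ?_⟩
  have h := hD m b (by exact_mod_cast hm) hmb
  rw [Nat.floor_natCast] at h
  have hmb' : m ≤ ⌊b⌋₊ := Nat.le_floor hmb
  have hsq : ∑ p ∈ Ioc m ⌊b⌋₊ with p.Prime, 12 * ((p : ℝ) ^ 2)⁻¹ ≤ 12 * (m : ℝ)⁻¹ := by
    rw [← mul_sum]
    gcongr
    calc _ ≤ ∑ p ∈ Ioc m ⌊b⌋₊, ((p : ℝ) ^ 2)⁻¹ :=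
          sum_le_sum_of_subset_of_nonneg (filter_subset _ _) fun _ _ _ => by positivity
      _ ≤ (m : ℝ)⁻¹ - (⌊b⌋₊ : ℝ)⁻¹ := sum_Ioc_inv_sq_le_sub (by lia) hmb'
      _ ≤ _ := sub_le_self _ (by positivity)
  have hdiff : |∑ p ∈ Ioc m ⌊b⌋₊ with p.Prime, (Real.log (((p : ℝ) - 2) / p) + 2 * (p : ℝ)⁻¹)| ≤
      12 * (m : ℝ)⁻¹ := by
    refine (abs_sum_le_sum_abs _ _).trans (le_trans (sum_le_sum fun p hp => ?_) hsq)
    have hp' : m < p := (mem_Ioc.1 (mem_filter.1 hp).1).1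
    exact abs_log_sub_two_div_add_le (by exact_mod_cast (by lia : 3 ≤ p))
  rw [sum_add_distrib, ← mul_sum] at hdiff
  rw [abs_le] at *
  constructor <;> linarith [h.1, h.2, hdiff.1, hdiff.2]

theorem eventually_log_le_mul_sqrt {ε : ℝ} (hε : 0 < ε) :
    ∀ᶠ x : ℝ in atTop, Real.log x ≤ ε * √x := by
  filter_upwards [(isLittleO_log_rpow_atTop (r := 1 / 2) (by norm_num)).bound hε] with x hx
  rw [← Real.sqrt_eq_rpow, Real.norm_of_nonneg (Real.sqrt_nonneg x)] at hx
  exact (le_abs_self _).trans hx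

theorem eventually_half_le_theta :
    ∀ᶠ x : ℝ in atTop, x / 2 ≤ Chebyshev.theta x := by
  filter_upwards [eventually_log_le_mul_sqrt (ε := 1 / 100) (by norm_num),
    eventually_ge_atTop 100] with x hl hx
  have h := Chebyshev.theta_ge' (x := x) (by linarith)
  have hl2 := Real.log_two_gt_d9
  have hs := Real.mul_self_sqrt (by linarith : 0 ≤ x)
  have hs1 : 1 ≤ √x := Real.one_le_sqrt.2 (by linarith)
  have h1 : Real.log (x + 2) ≤ 2 * Real.log x := by
    have : Real.log (x ^ 2) = 2 * Real.log x := by simp [Real.log_pow]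
    rw [← this]
    exact Real.log_le_log (by linarith) (by nlinarith)
  have h2 : √x * Real.log x ≤ 1 / 100 * x := by nlinarith
  have h3 : √x ≤ x := by nlinarith
  nlinarith

/-- Chebyshev's relation `π(x) log x ~ θ(x)`. -/
theorem tendsto_primeCounting_mul_log_div_theta :
    Tendsto (fun x : ℝ => (Nat.primeCounting ⌊x⌋₊ : ℝ) * Real.log x / Chebyshev.theta x)
      atTop (nhds 1) := by
  obtain ⟨K, hK⟩ := Chebyshev.primeCounting_sub_theta_div_log_isBigO.bound
  rw [tendsto_iff_norm_sub_tendsto_zero]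
  have hlim : Tendsto (fun x : ℝ => 2 * K * (Real.log x)⁻¹) atTop (nhds 0) := by
    simpa using Real.tendsto_log_atTop.inv_tendsto_atTop.const_mul (2 * K)
  refine squeeze_zero' (Eventually.of_forall fun _ => norm_nonneg _) ?_ hlim
  filter_upwards [hK, eventually_half_le_theta, eventually_ge_atTop 2] with x hx hθ h2
  have hx0 : (0 : ℝ) < x := by linarith
  have hl : 0 < Real.log x := Real.log_pos (by linarith)
  have hθ0 : 0 < Chebyshev.theta x := by linarith
  have e : (Nat.primeCounting ⌊x⌋₊ : ℝ) * Real.log x / Chebyshev.theta x - 1 =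
      (Nat.primeCounting ⌊x⌋₊ - Chebyshev.theta x / Real.log x) *
        (Real.log x / Chebyshev.theta x) := by field_simp
  rw [Real.norm_of_nonneg (by positivity : 0 ≤ x / Real.log x ^ 2)] at hx
  rw [e, norm_mul, Real.norm_of_nonneg (by positivity : 0 ≤ Real.log x / Chebyshev.theta x)]
  calc _ ≤ (K * (x / Real.log x ^ 2)) * (Real.log x / (x / 2)) := by
        gcongr
        exact (norm_nonneg _).trans hx
    _ = _ := by field_simp

theorem log_primorial' {n : ℕ} (hn : 1 ≤ n) :
    Real.log (primorial' n) = Chebyshev.theta (nthPrime n) := by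
  obtain ⟨m, rfl⟩ : ∃ m, n = m + 1 := ⟨n - 1, by lia⟩
  have hset : Nat.primesLE (nthPrime (m + 1)) = (range (m + 1)).image (Nat.nth Nat.Prime) := by
    ext p
    simp only [Nat.mem_primesLE, mem_image, mem_range, nthPrime, Nat.add_sub_cancel]
    constructor
    · rintro ⟨hle, hp⟩
      refine ⟨Nat.count Nat.Prime p, ?_, Nat.nth_count hp⟩
      rw [Nat.lt_succ_iff, ← Nat.nth_le_nth Nat.infinite_setOfPred_prime, Nat.nth_count hp]
      exact hle
    · rintro ⟨i, hi, rfl⟩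
      exact ⟨Nat.nth_monotone Nat.infinite_setOfPred_prime (by lia), Nat.prime_nth_prime i⟩
  rw [Chebyshev.theta_eq_sum_primesLE_log, hset,
    sum_image fun i _ j _ h => Nat.nth_injective Nat.infinite_setOfPred_prime h, primorial',
    Nat.cast_prod, Real.log_prod fun i _ => by exact_mod_cast (Nat.prime_nth_prime i).ne_zero]

theorem primeCounting_nthPrime {n : ℕ} (hn : 1 ≤ n) : Nat.primeCounting (nthPrime n) = n := by
  have h := Nat.count_nth_succ_of_infinite Nat.infinite_setOfPred_prime (n - 1)
  rw [Nat.sub_add_cancel hn] at h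
  exact h

theorem tendsto_nthPrime : Tendsto nthPrime atTop atTop :=
  tendsto_atTop_mono (fun n => by
    have := Nat.add_two_le_nth_prime (n - 1)
    simp only [id, nthPrime]
    lia) tendsto_id

/-- For every real `c` with `1/2 ≤ c ≤ 1`,
`n² · ∏_{p prime, pₙ < p ≤ (pₙ#)^c} (p−2)/p → 1/c²` as `n → ∞`. -/
theorem statement1 (c : ℝ) (hc₁ : 1 / 2 ≤ c) (hc₂ : c ≤ 1) :
    Tendsto (fun n : ℕ =>
      (n : ℝ) ^ 2 *
        ∏ p ∈ (Finset.range (Nat.floor ((primorial' n : ℝ) ^ c) + 1)).filter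
            (fun p => p.Prime ∧ nthPrime n < p ∧ (p : ℝ) ≤ (primorial' n : ℝ) ^ c),
          ((p : ℝ) - 2) / p)
      atTop (nhds (1 / c ^ 2)) := by
  obtain ⟨D, hD⟩ := exists_abs_sum_log_prime_sub_two_div_add_le
  have hc0 : 0 < c := by linarith
  have hy : Tendsto (fun n => (nthPrime n : ℝ)) atTop atTop :=
    tendsto_natCast_atTop_atTop.comp tendsto_nthPrime
  set err : ℕ → ℝ := fun n =>
    ∑ p ∈ Ioc (nthPrime n) ⌊(primorial' n : ℝ) ^ c⌋₊ with p.Prime,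
      Real.log (((p : ℝ) - 2) / p) + 2 * (Real.log (Real.log ((primorial' n : ℝ) ^ c)) -
        Real.log (Real.log (nthPrime n))) with herr
  have hlarge : ∀ᶠ n : ℕ in atTop, 1 ≤ n ∧ 2 ≤ nthPrime n ∧
      Real.log ((primorial' n : ℝ) ^ c) = c * Chebyshev.theta (nthPrime n) ∧
      0 < Chebyshev.theta (nthPrime n) ∧ (nthPrime n : ℝ) ≤ (primorial' n : ℝ) ^ c := by
    filter_upwards [eventually_ge_atTop 1, tendsto_nthPrime.eventually_ge_atTop 2,
      hy.eventually eventually_half_le_theta,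
      hy.eventually (eventually_log_le_mul_sqrt (ε := 1 / 4) (by norm_num))] with n hn h2 hθ hl
    have h2' : (2 : ℝ) ≤ nthPrime n := by exact_mod_cast h2
    have hpos : 0 < (primorial' n : ℝ) := by
      exact_mod_cast prod_pos fun i _ => (Nat.prime_nth_prime i).pos
    have hlog : Real.log ((primorial' n : ℝ) ^ c) = c * Chebyshev.theta (nthPrime n) := by
      rw [Real.log_rpow hpos, log_primorial' hn]
    refine ⟨hn, h2, hlog, by linarith, ?_⟩
    rw [← Real.log_le_log_iff (by linarith) (by positivity), hlog]
    have hs := Real.mul_self_sqrt (by linarith : (0 : ℝ) ≤ nthPrime n)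
    have hs1 : 1 ≤ √(nthPrime n : ℝ) := Real.one_le_sqrt.2 (by linarith)
    have h3 : √(nthPrime n : ℝ) ≤ nthPrime n := by nlinarith
    nlinarith
  have herr0 : Tendsto err atTop (nhds 0) := by
    have hlim : Tendsto (fun n => 2 * (D / Real.log (nthPrime n)) + 12 * (nthPrime n : ℝ)⁻¹)
        atTop (nhds 0) := by
      have h1 := ((Real.tendsto_log_atTop.comp hy).inv_tendsto_atTop.const_mul D).const_mul 2
      have h2 := hy.inv_tendsto_atTop.const_mul 12
      simpa [div_eq_mul_inv] using h1.add h2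
    refine squeeze_zero_norm' ?_ hlim
    filter_upwards [hlarge] with n ⟨_, h2, _, _, hle⟩
    exact hD _ _ h2 hle
  have hmain : Tendsto (fun n : ℕ => 1 / c ^ 2 *
      ((Nat.primeCounting ⌊(nthPrime n : ℝ)⌋₊ : ℝ) * Real.log (nthPrime n) /
        Chebyshev.theta (nthPrime n)) ^ 2 * Real.exp (err n)) atTop (nhds (1 / c ^ 2)) := by
    have h1 := ((tendsto_primeCounting_mul_log_div_theta.comp hy).pow 2).const_mul (1 / c ^ 2)
    have h2 := (Real.continuous_exp.tendsto 0).comp herr0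
    simpa using h1.mul h2
  refine hmain.congr' ?_
  filter_upwards [hlarge] with n ⟨hn, h2, hlog, hθ, hle⟩
  have hset : (Finset.range (Nat.floor ((primorial' n : ℝ) ^ c) + 1)).filter
      (fun p => p.Prime ∧ nthPrime n < p ∧ (p : ℝ) ≤ (primorial' n : ℝ) ^ c) =
      (Ioc (nthPrime n) ⌊(primorial' n : ℝ) ^ c⌋₊).filter Nat.Prime := by
    ext p
    have := Nat.le_floor_iff (n := p) (by positivity : 0 ≤ (primorial' n : ℝ) ^ c)
    simp only [mem_filter, mem_range, mem_Ioc, Nat.lt_succ_iff, this]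
    tauto
  have hlp : 0 < Real.log (nthPrime n) := Real.log_pos (by exact_mod_cast h2)
  have hprod : ∏ p ∈ Ioc (nthPrime n) ⌊(primorial' n : ℝ) ^ c⌋₊ with p.Prime,
      ((p : ℝ) - 2) / p =
      Real.exp (err n) * (Real.log (nthPrime n) / (c * Chebyshev.theta (nthPrime n))) ^ 2 := by
    have hpp : ∀ p ∈ (Ioc (nthPrime n) ⌊(primorial' n : ℝ) ^ c⌋₊).filter Nat.Prime,
        0 < ((p : ℝ) - 2) / p := by
      intro p hp
      have hlt : 2 < p := h2.trans_lt (mem_Ioc.1 (mem_filter.1 hp).1).1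
      have hlt' : (2 : ℝ) < p := by exact_mod_cast hlt
      exact div_pos (by linarith) (by linarith)
    have hq : 0 < Real.log (nthPrime n) / (c * Chebyshev.theta (nthPrime n)) := by positivity
    rw [← Real.exp_log (prod_pos hpp), Real.log_prod fun p hp => (hpp p hp).ne',
      ← Real.exp_log (pow_pos hq 2), ← Real.exp_add, Real.log_pow,
      Real.log_div hlp.ne' (by positivity)]
    simp only [herr, hlog]
    congr 1
    push_cast
    ring
  rw [hset, hprod, Nat.floor_natCast, primeCounting_nthPrime hn]
  field_simp
end

section
/- For every real x ≥ 3·10^120, |1/π(x) − (log x)/ϑ(x)| < 0.0050222 · (log x)/ϑ(x); equivalently, |ϑ(x)/(π(x) · log x) − 1| < 0.0050222. -/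
open Finset

/-- `primePi x` is π(x), the number of primes `p ≤ x`. -/
noncomputable def primePi (x : ℝ) : ℕ :=
  ((Finset.range (Nat.floor x + 1)).filter (fun p : ℕ => p.Prime ∧ (p : ℝ) ≤ x)).card

/-- `theta x` is Chebyshev's function ϑ(x) = ∑_{p prime, p ≤ x} log p. -/
noncomputable def theta (x : ℝ) : ℝ :=
  ∑ p ∈ (Finset.range (Nat.floor x + 1)).filter (fun p : ℕ => p.Prime ∧ (p : ℝ) ≤ x),
    Real.log p

section

open ArithmeticFunction

lemma primePi_eq (x : ℝ) (hx : 0 ≤ x) : primePi x = Nat.primeCounting ⌊x⌋₊ := by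
  rw [primePi, Nat.primeCounting, Nat.primeCounting', Nat.count_eq_card_filter_range]
  congr 1
  ext p
  simp only [mem_filter, mem_range, Nat.lt_add_one_iff, Nat.le_floor_iff hx]
  tauto

lemma theta_eq (x : ℝ) (hx : 0 ≤ x) : theta x = Chebyshev.theta x := by
  rw [theta, Chebyshev.theta]
  congr 1
  ext p
  simp only [mem_filter, mem_range, Nat.lt_add_one_iff, Nat.le_floor_iff hx, mem_Ioc]
  constructor
  · rintro ⟨h, hp, -⟩
    exact ⟨⟨hp.pos, h⟩, hp⟩
  · rintro ⟨⟨-, h⟩, hp⟩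
    exact ⟨h, hp, h⟩

lemma log_factorial_eq_sum_vonMangoldt {N M : ℕ} (h : N ≤ M) :
    Real.log N.factorial = ∑ d ∈ Ioc 0 M, Λ d * ((N / d : ℕ) : ℝ) := by
  have h₁ : Real.log N.factorial = ∑ n ∈ Ioc 0 N, Real.log n := by
    clear h
    induction N with
    | zero => simp
    | succ n ih =>
      rw [Nat.factorial_succ, Nat.cast_mul, Real.log_mul (by positivity) (by positivity), ih,
        sum_Ioc_succ_top (Nat.zero_le n), add_comm]
  have h₂ := sum_Ioc_mul_zeta_eq_sum Λ N
  rw [vonMangoldt_mul_zeta] at h₂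
  rw [h₁]
  simp only [log_apply] at h₂
  rw [h₂]
  refine sum_subset (Ioc_subset_Ioc_right h) fun d _ hd' ↦ ?_
  have : N < d := by simp only [mem_Ioc] at *; omega
  simp [Nat.div_eq_of_lt this]

lemma log_factorial_le {m : ℕ} (hm : 1 ≤ m) :
    Real.log m.factorial ≤ (m + 1) * Real.log m - m + 1 := by
  induction m, hm using Nat.le_induction with
  | base => simp
  | succ n hn ih =>
    have hn' : (0 : ℝ) < n := by exact_mod_cast hn
    rw [Nat.factorial_succ, Nat.cast_mul, Real.log_mul (by positivity) (by positivity)]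
    push_cast
    have h := Real.one_sub_inv_le_log_of_pos (x := ((n : ℝ) + 1) / n) (by positivity)
    rw [Real.log_div (by positivity) (by positivity)] at h
    have h' : 1 ≤ ((n : ℝ) + 1) * (Real.log (n + 1) - Real.log n) := by
      calc (1 : ℝ) = (n + 1) * (1 - (((n : ℝ) + 1) / n)⁻¹) := by field_simp; ring
        _ ≤ _ := by gcongr
    linarith

lemma le_log_factorial (m : ℕ) : m * Real.log (m + 1) - m ≤ Real.log m.factorial := by
  induction m with
  | zero => simp
  | succ n ih =>
    rw [Nat.factorial_succ, Nat.cast_mul, Real.log_mul (by positivity) (by positivity)]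
    push_cast
    have h := Real.log_le_sub_one_of_pos (x := ((n : ℝ) + 1 + 1) / (n + 1)) (by positivity)
    rw [Real.log_div (by positivity) (by positivity)] at h
    have h' : ((n : ℝ) + 1) * (Real.log (n + 1 + 1) - Real.log (n + 1)) ≤ 1 := by
      calc _ ≤ ((n : ℝ) + 1) * (((n : ℝ) + 1 + 1) / (n + 1) - 1) := by gcongr
        _ = 1 := by field_simp; ring
    linarith

lemma abs_log_factorial_div_sub_le {n k : ℕ} (hk : 0 < k) (hkn : k ≤ n) :
    |Real.log (n / k).factorial - ((n : ℝ) / k * (Real.log n - Real.log k) - n / k)|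
      ≤ Real.log n + 2 := by
  have hk' : (1 : ℝ) ≤ k := by exact_mod_cast hk
  have hkn' : (k : ℝ) ≤ n := by exact_mod_cast hkn
  have hn' : (0 : ℝ) < n := by linarith
  have hm : 1 ≤ n / k := (Nat.one_le_div_iff hk).2 hkn
  have hm' : (1 : ℝ) ≤ (n / k : ℕ) := by exact_mod_cast hm
  rw [← Real.log_div (by positivity) (by positivity)]
  have hle : ((n / k : ℕ) : ℝ) ≤ (n : ℝ) / k := Nat.cast_div_le
  have hlt : (n : ℝ) / k ≤ (n / k : ℕ) + 1 := by
    rw [div_le_iff₀ (by positivity)]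
    have := Nat.lt_div_mul_add (a := n) hk
    have h : n ≤ (n / k + 1) * k := by linarith
    exact_mod_cast h
  have hyn : (n : ℝ) / k ≤ n := div_le_self hn'.le hk'
  have hU := log_factorial_le hm
  have hL := le_log_factorial (n / k)
  generalize (n : ℝ) / k = y at *
  generalize n / k = m at *
  have hlogy : 0 ≤ Real.log y := Real.log_nonneg (by linarith)
  have hlogyn : Real.log y ≤ Real.log n := Real.log_le_log (by linarith) hyn
  have h₁ : Real.log m ≤ Real.log y := Real.log_le_log (by linarith) hle
  have h₂ : Real.log y ≤ Real.log (m + 1) := Real.log_le_log (by linarith) hlt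
  have h₃ : ((m : ℝ) + 1) * Real.log m ≤ (y + 1) * Real.log y := by
    gcongr
    linarith
  have h₄ : (y - 1) * Real.log y ≤ m * Real.log (m + 1) := by
    gcongr
    linarith
  rw [abs_le]
  constructor <;> linarith

/-- Chebyshev's combination `T(n) - T(n/2) - T(n/3) - T(n/5) + T(n/30)` of log-factorials. -/
noncomputable def chebyshevE (n : ℕ) : ℝ :=
  Real.log n.factorial - Real.log (n / 2).factorial - Real.log (n / 3).factorial
    - Real.log (n / 5).factorial + Real.log (n / 30).factorial

lemma chebyshevE_eq_sum (n : ℕ) :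
    chebyshevE n = ∑ d ∈ Ioc 0 n, Λ d * (((n / d : ℕ) : ℝ) - (n / d / 2 : ℕ) - (n / d / 3 : ℕ)
      - (n / d / 5 : ℕ) + (n / d / 30 : ℕ)) := by
  rw [chebyshevE, log_factorial_eq_sum_vonMangoldt le_rfl,
    log_factorial_eq_sum_vonMangoldt (Nat.div_le_self n 2),
    log_factorial_eq_sum_vonMangoldt (Nat.div_le_self n 3),
    log_factorial_eq_sum_vonMangoldt (Nat.div_le_self n 5),
    log_factorial_eq_sum_vonMangoldt (Nat.div_le_self n 30), ← sum_sub_distrib,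
    ← sum_sub_distrib, ← sum_sub_distrib, ← sum_add_distrib]
  refine sum_congr rfl fun d _ ↦ ?_
  rw [Nat.div_right_comm n 2, Nat.div_right_comm n 3, Nat.div_right_comm n 5,
    Nat.div_right_comm n 30]
  ring

lemma chebyshevE_le_psi (n : ℕ) : chebyshevE n ≤ Chebyshev.psi n := by
  rw [chebyshevE_eq_sum, Chebyshev.psi, Nat.floor_natCast]
  refine sum_le_sum fun d _ ↦ mul_le_of_le_one_right vonMangoldt_nonneg ?_
  generalize n / d = m
  have : m + m / 30 ≤ 1 + m / 2 + m / 3 + m / 5 := by omega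
  have : (m : ℝ) + (m / 30 : ℕ) ≤ 1 + (m / 2 : ℕ) + (m / 3 : ℕ) + (m / 5 : ℕ) := by
    exact_mod_cast this
  linarith

lemma psi_sub_psi_le_chebyshevE (n : ℕ) :
    Chebyshev.psi n - Chebyshev.psi (n / 6 : ℕ) ≤ chebyshevE n := by
  rw [chebyshevE_eq_sum, Chebyshev.psi, Chebyshev.psi, Nat.floor_natCast, Nat.floor_natCast,
    ← sum_sdiff (Ioc_subset_Ioc_right (Nat.div_le_self n 6)), add_sub_cancel_right,
    ← sum_sdiff (Ioc_subset_Ioc_right (Nat.div_le_self n 6))]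
  have hnonneg (m : ℕ) : (0 : ℝ) ≤ (m : ℝ) - (m / 2 : ℕ) - (m / 3 : ℕ) - (m / 5 : ℕ)
      + (m / 30 : ℕ) := by
    have : m / 2 + m / 3 + m / 5 ≤ m + m / 30 := by omega
    have : ((m / 2 : ℕ) : ℝ) + (m / 3 : ℕ) + (m / 5 : ℕ) ≤ m + (m / 30 : ℕ) := by
      exact_mod_cast this
    linarith
  refine (sum_le_sum fun d hd ↦ ?_).trans
    (le_add_of_nonneg_right (sum_nonneg fun d _ ↦ mul_nonneg vonMangoldt_nonneg (hnonneg _)))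
  refine le_mul_of_one_le_right vonMangoldt_nonneg ?_
  simp only [mem_sdiff, mem_Ioc] at hd
  have h₁ : 1 ≤ n / d := (Nat.one_le_div_iff hd.1.1).2 hd.1.2
  have h₂ : n / d < 6 := by
    rw [Nat.div_lt_iff_lt_mul hd.1.1]
    omega
  generalize n / d = m at *
  interval_cases m <;> norm_num

lemma chebyshevE_bounds {n : ℕ} (hn : 30 ≤ n) :
    0.92 * n - 5 * (Real.log n + 2) ≤ chebyshevE n ∧
      chebyshevE n ≤ 0.922 * n + 5 * (Real.log n + 2) := by
  have h₁ := abs_le.1 (abs_log_factorial_div_sub_le (n := n) (k := 1) (by norm_num) (by omega))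
  have h₂ := abs_le.1 (abs_log_factorial_div_sub_le (n := n) (k := 2) (by norm_num) (by omega))
  have h₃ := abs_le.1 (abs_log_factorial_div_sub_le (n := n) (k := 3) (by norm_num) (by omega))
  have h₅ := abs_le.1 (abs_log_factorial_div_sub_le (n := n) (k := 5) (by norm_num) (by omega))
  have h₃₀ := abs_le.1 (abs_log_factorial_div_sub_le (n := n) (k := 30) (by norm_num) hn)
  have hlog : Real.log 30 = Real.log 2 + Real.log 3 + Real.log 5 := by
    rw [← Real.log_mul (by norm_num) (by norm_num), ← Real.log_mul (by norm_num) (by norm_num)]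
    norm_num
  simp only [Nat.div_one, Nat.cast_one, div_one, Real.log_one, Nat.cast_ofNat, hlog]
    at h₁ h₂ h₃ h₅ h₃₀
  have hn0 : (0 : ℝ) ≤ n := by positivity
  have a₁ := mul_le_mul_of_nonneg_left Real.log_two_gt_d9.le hn0
  have a₂ := mul_le_mul_of_nonneg_left Real.log_two_lt_d9.le hn0
  have a₃ := mul_le_mul_of_nonneg_left Real.log_three_gt_d9.le hn0
  have a₄ := mul_le_mul_of_nonneg_left Real.log_three_lt_d9.le hn0
  have a₅ := mul_le_mul_of_nonneg_left Real.log_five_gt_d9.le hn0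
  have a₆ := mul_le_mul_of_nonneg_left Real.log_five_lt_d9.le hn0
  rw [chebyshevE]
  constructor <;> linarith

lemma psi_natCast_le (n : ℕ) : Chebyshev.psi n ≤ 1.12 * n + 6 * 10 ^ 6 := by
  induction n using Nat.strong_induction_on with
  | _ n ih =>
    have hn0 : (0 : ℝ) ≤ n := by positivity
    rcases lt_or_ge n (10 ^ 6) with h | h
    · have h' : (n : ℝ) ≤ 10 ^ 6 := by exact_mod_cast h.le
      have h4 : Real.log 4 ≤ 1.4 := by
        rw [show (4 : ℝ) = 2 ^ 2 by norm_num, Real.log_pow]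
        push_cast
        linarith [Real.log_two_lt_d9]
      have := Chebyshev.psi_le_const_mul_self hn0
      nlinarith
    · have h' : (10 : ℝ) ^ 6 ≤ n := by exact_mod_cast h
      have h₁ := psi_sub_psi_le_chebyshevE n
      have h₂ := (chebyshevE_bounds (n := n) (by omega)).2
      have h₃ := ih (n / 6) (by omega)
      have h₄ : ((n / 6 : ℕ) : ℝ) ≤ (n : ℝ) / 6 := by exact_mod_cast Nat.cast_div_le (α := ℝ)
      have h₅ : Real.log n ≤ 14 + (n / 10 ^ 6 - 1) := by
        have h := Real.log_le_sub_one_of_pos (x := (n : ℝ) / 10 ^ 6) (by positivity)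
        rw [Real.log_div (by positivity) (by positivity)] at h
        have : Real.log ((10 : ℝ) ^ 6) ≤ 14 := by
          rw [Real.log_pow, Real.log_ten_eq]
          push_cast
          linarith [Real.log_two_lt_d9, Real.log_five_lt_d9]
        generalize Real.log ((10 : ℝ) ^ 6) = c at *
        linarith
      linarith

lemma theta_le_of_large {t : ℝ} (ht : 10 ^ 10 ≤ t) : Chebyshev.theta t ≤ 1.13 * t := by
  have h₁ := Chebyshev.theta_le_psi t
  rw [Chebyshev.psi_eq_psi_coe_floor] at h₁
  have h₂ := psi_natCast_le ⌊t⌋₊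
  have h₃ := Nat.floor_le (a := t) (by linarith)
  linarith

lemma le_theta_of_large {s : ℝ} (hs : 10 ^ 30 ≤ s) :
    0.9 * s ^ 4 ≤ Chebyshev.theta (s ^ 4) := by
  have hs0 : 0 < s := by linarith
  have hs1 : 1 ≤ s := by linarith
  have hx1 : 1 ≤ s ^ 4 := one_le_pow₀ hs1
  have hlog : Real.log (s ^ 4) ≤ 4 * s := by
    rw [Real.log_pow]
    push_cast
    linarith [Real.log_le_sub_one_of_pos hs0]
  have hsqrt : √(s ^ 4) = s ^ 2 := by
    rw [show s ^ 4 = (s ^ 2) ^ 2 by ring]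
    exact Real.sqrt_sq (by positivity)
  have h₁ := Chebyshev.psi_sub_theta_le hx1
  rw [hsqrt, Chebyshev.psi_eq_psi_coe_floor] at h₁
  have hsx : s ≤ s ^ 4 := le_self_pow₀ hs1 (by norm_num)
  have hfl : 30 ≤ ⌊s ^ 4⌋₊ := Nat.le_floor (by push_cast; linarith)
  have h₂ := (chebyshevE_bounds hfl).1.trans (chebyshevE_le_psi _)
  have h₃ := Nat.floor_le (a := s ^ 4) (by positivity)
  have h₄ := (Nat.sub_one_lt_floor (s ^ 4)).le
  have h₅ : Real.log ⌊s ^ 4⌋₊ ≤ Real.log (s ^ 4) :=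
    Real.log_le_log (by exact_mod_cast (by omega : 0 < ⌊s ^ 4⌋₊)) h₃
  have h₆ : 2 * s ^ 2 * Real.log (s ^ 4) ≤ 8 * s ^ 3 := by
    calc _ ≤ 2 * s ^ 2 * (4 * s) := by gcongr
      _ = _ := by ring
  have h₇ : 10 ^ 30 * s ^ 3 ≤ s ^ 4 := by
    calc _ ≤ s * s ^ 3 := by gcongr
      _ = _ := by ring
  have h₈ : s ≤ s ^ 3 := le_self_pow₀ hs1 (by norm_num)
  linarith

lemma integral_theta_le_of_small {T : ℝ} (hT : 2 ≤ T) :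
    ∫ t in (2 : ℝ)..T, Chebyshev.theta t / (t * Real.log t ^ 2) ≤ 3 * T := by
  have hint : IntervalIntegrable (fun t ↦ Chebyshev.theta t / (t * Real.log t ^ 2))
      MeasureTheory.volume 2 T := by
    rw [intervalIntegrable_iff_integrableOn_Icc_of_le hT]
    exact Chebyshev.integrableOn_theta_div_id_mul_log_sq T
  calc _ ≤ ∫ _ in (2 : ℝ)..T, (3 : ℝ) := by
        refine intervalIntegral.integral_mono_on hT hint (by simp) fun t ht ↦ ?_
        have ht0 : 0 < t := by linarith [ht.1]
        have hl : 0.69 ≤ Real.log t :=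
          le_trans (by linarith [Real.log_two_gt_d9]) (Real.log_le_log two_pos ht.1)
        have h4 : Real.log 4 ≤ 1.4 := by
          rw [show (4 : ℝ) = 2 ^ 2 by norm_num, Real.log_pow]
          push_cast
          linarith [Real.log_two_lt_d9]
        rw [div_le_iff₀ (by positivity)]
        have h₁ := Chebyshev.theta_le_log4_mul_x ht0.le
        have h₂ : 0.69 ^ 2 ≤ Real.log t ^ 2 := by gcongr
        nlinarith
    _ ≤ _ := by
        rw [intervalIntegral.integral_const, smul_eq_mul]
        linarith

lemma integral_theta_le_of_large {T x : ℝ} (hT : 10 ^ 50 ≤ T) (hTx : T ≤ x) :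
    ∫ t in T..x, Chebyshev.theta t / (t * Real.log t ^ 2) ≤ 1.1865 * x / Real.log x ^ 2 := by
  have hT2 : 2 ≤ T := by linarith
  have hlog {t : ℝ} (ht : T ≤ t) : 100 ≤ Real.log t := by
    refine le_trans ?_ (Real.log_le_log (by positivity) (hT.trans ht))
    rw [Real.log_pow, Real.log_ten_eq]
    push_cast
    linarith [Real.log_two_gt_d9, Real.log_five_gt_d9]
  have hint : IntervalIntegrable (fun t ↦ Chebyshev.theta t / (t * Real.log t ^ 2))
      MeasureTheory.volume T x := by
    rw [intervalIntegrable_iff_integrableOn_Icc_of_le hTx]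
    exact (Chebyshev.integrableOn_theta_div_id_mul_log_sq x).mono_set
      (Set.Icc_subset_Icc_left hT2)
  have hderiv : ∀ t ∈ Set.uIcc T x, HasDerivAt (fun t ↦ 1.1865 * t / Real.log t ^ 2)
      (1.1865 * (1 / Real.log t ^ 2 - 2 / Real.log t ^ 3)) t := by
    intro t ht
    rw [Set.uIcc_of_le hTx] at ht
    have ht0 : t ≠ 0 := by linarith [ht.1]
    have hl0 : Real.log t ≠ 0 := by linarith [hlog ht.1]
    refine (((hasDerivAt_id' t).const_mul 1.1865).fun_div
      ((Real.hasDerivAt_log ht0).fun_pow 2) (pow_ne_zero 2 hl0)).congr_deriv ?_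
    field_simp
    push_cast
    ring
  have hint' : IntervalIntegrable (fun t ↦ 1.1865 * (1 / Real.log t ^ 2 - 2 / Real.log t ^ 3))
      MeasureTheory.volume T x := by
    refine ContinuousOn.intervalIntegrable fun t ht ↦ ContinuousAt.continuousWithinAt ?_
    rw [Set.uIcc_of_le hTx] at ht
    have ht0 : t ≠ 0 := by linarith [ht.1]
    have hl0 : Real.log t ≠ 0 := by linarith [hlog ht.1]
    fun_prop (disch := simp [hl0])
  calc _ ≤ ∫ t in T..x, 1.1865 * (1 / Real.log t ^ 2 - 2 / Real.log t ^ 3) := by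
        refine intervalIntegral.integral_mono_on hTx hint hint' fun t ht ↦ ?_
        have ht0 : 0 < t := by linarith [ht.1]
        have hl := hlog ht.1
        have h₁ := theta_le_of_large (t := t) (by linarith [ht.1])
        calc _ ≤ 1.13 * t / (t * Real.log t ^ 2) := by gcongr
          _ = 1.13 * Real.log t / Real.log t ^ 3 := by field_simp
          _ ≤ 1.1865 * (Real.log t - 2) / Real.log t ^ 3 :=
            div_le_div_of_nonneg_right (by linarith) (by positivity)
          _ = _ := by field_simp
    _ = 1.1865 * x / Real.log x ^ 2 - 1.1865 * T / Real.log T ^ 2 :=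
        intervalIntegral.integral_eq_sub_of_hasDerivAt hderiv hint'
    _ ≤ _ := sub_le_self _ (by positivity)

lemma log_mul_integral_theta_lt {s : ℝ} (hs : 10 ^ 30 ≤ s) (hs' : 3 * 10 ^ 120 ≤ s ^ 4) :
    Real.log (s ^ 4) * ∫ t in (2 : ℝ)..(s ^ 4), Chebyshev.theta t / (t * Real.log t ^ 2)
      < 0.0045 * s ^ 4 := by
  have hs0 : 0 < s := by linarith
  have hL : 275 ≤ Real.log (s ^ 4) := by
    refine le_trans ?_ (Real.log_le_log (by positivity)
      (le_trans (by norm_num) hs' : (10 : ℝ) ^ 120 ≤ s ^ 4))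
    rw [Real.log_pow, Real.log_ten_eq]
    push_cast
    linarith [Real.log_two_gt_d9, Real.log_five_gt_d9]
  have hlog : Real.log (s ^ 4) ≤ 4 * s := by
    rw [Real.log_pow]
    push_cast
    linarith [Real.log_le_sub_one_of_pos hs0]
  have hsplit := intervalIntegral.integral_add_adjacent_intervals (a := 2) (b := 10 ^ 50)
    (c := s ^ 4) (μ := MeasureTheory.volume)
    (f := fun t ↦ Chebyshev.theta t / (t * Real.log t ^ 2))
    (by
      rw [intervalIntegrable_iff_integrableOn_Icc_of_le (by norm_num)]
      exact Chebyshev.integrableOn_theta_div_id_mul_log_sq _)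
    (by
      rw [intervalIntegrable_iff_integrableOn_Icc_of_le (by linarith)]
      exact (Chebyshev.integrableOn_theta_div_id_mul_log_sq _).mono_set
        (Set.Icc_subset_Icc_left (by norm_num)))
  rw [← hsplit]
  have h₁ := integral_theta_le_of_small (T := 10 ^ 50) (by norm_num)
  have h₂ := integral_theta_le_of_large (T := 10 ^ 50) (x := s ^ 4) le_rfl (by linarith)
  have h₃ : 10 ^ 90 * s ≤ s ^ 4 := by
    calc (10 : ℝ) ^ 90 * s = (10 ^ 30) ^ 3 * s := by norm_num
      _ ≤ s ^ 3 * s := by gcongr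
      _ = _ := by ring
  calc _ ≤ Real.log (s ^ 4) * (3 * 10 ^ 50 + 1.1865 * s ^ 4 / Real.log (s ^ 4) ^ 2) := by
        gcongr
    _ = 3 * 10 ^ 50 * Real.log (s ^ 4) + 1.1865 * s ^ 4 / Real.log (s ^ 4) := by
        field_simp
    _ ≤ 3 * 10 ^ 50 * (4 * s) + 1.1865 * s ^ 4 / 275 := by gcongr
    _ < _ := by linarith

end

theorem statement3 (x : ℝ) (hx : 3 * 10 ^ 120 ≤ x) :
    |1 / (primePi x : ℝ) - Real.log x / theta x| < (0.0050222 : ℝ) * (Real.log x / theta x) := by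
  have hx0 : 0 ≤ x := by linarith
  rw [primePi_eq x hx0, theta_eq x hx0, Chebyshev.primeCounting_eq_theta_div_log_add_integral
    (by linarith)]
  obtain ⟨s, hs0, rfl⟩ : ∃ s : ℝ, 0 ≤ s ∧ s ^ 4 = x :=
    ⟨√√x, by positivity, by
      rw [show √√x ^ 4 = (√√x ^ 2) ^ 2 by ring, Real.sq_sqrt (by positivity), Real.sq_sqrt hx0]⟩
  have hs : 10 ^ 30 ≤ s := by
    refine le_of_pow_le_pow_left₀ (n := 4) (by norm_num) hs0 ?_
    linarith
  have hL : 0 < Real.log (s ^ 4) := Real.log_pos (by linarith)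
  have hI := log_mul_integral_theta_lt hs hx
  have hv := le_theta_of_large hs
  have hI0 : 0 ≤ ∫ t in (2 : ℝ)..(s ^ 4), Chebyshev.theta t / (t * Real.log t ^ 2) := by
    refine intervalIntegral.integral_nonneg (by linarith) fun t ht ↦ ?_
    have := Chebyshev.theta_nonneg t
    have : 0 ≤ t := by linarith [ht.1]
    positivity
  generalize (∫ t in (2 : ℝ)..(s ^ 4), Chebyshev.theta t / (t * Real.log t ^ 2)) = I at *
  generalize Chebyshev.theta (s ^ 4) = v at *
  generalize Real.log (s ^ 4) = L at *
  have hv0 : 0 < v := by linarith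
  have hLI : 0 ≤ L * I := by positivity
  have key : 1 / (v / L + I) - L / v = -(L * I / (v + L * I)) * (L / v) := by
    field_simp
    ring
  rw [key, abs_mul, abs_neg, abs_of_nonneg (by positivity), abs_of_pos (by positivity)]
  gcongr
  rw [div_lt_iff₀ (by positivity)]
  linarith
end
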